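/- Let X = λ₁T + λ₂Q + λ₃n be a vector field along α where λ₁, λ₂, λ₃ are real constants with λ₁ ≠ 0. Then X is Fermi–Walker transported along α if and only if either the geodesic torsion τ_g vanishes identically (α is a line of curvature) or λ₂ = λ₃ = 0. -/

import Mathlib

/-- The Galilean scalar product on `ℝ³`: `v₁w₁` if `v₁ ≠ 0` or `w₁ ≠ 0`,
and `v₂w₂ + v₃w₃` if `v₁ = 0` and `w₁ = 0`. -/
noncomputable def gProd (v w : Fin 3 → ℝ) : ℝ :=
  if v 0 ≠ 0 ∨ w 0 ≠ 0 then v 0 * w 0 else v 1 * w 1 + v 2 * w 2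

/-- The admissible curve `α(x) = (x, y(x), z(x))` in Galilean 3-space. -/
noncomputable def curve (y z : ℝ → ℝ) : ℝ → Fin 3 → ℝ :=
  fun x => ![x, y x, z x]

/-- The Fermi–Walker derivative along `α = curve y z`:
`∇̃_T X = X' − ⟨T,X⟩A + ⟨A,X⟩T`, where `T = α'` and `A = T' = α''`. -/
noncomputable def FW (y z : ℝ → ℝ) (X : ℝ → Fin 3 → ℝ) (x : ℝ) : Fin 3 → ℝ :=
  deriv X x
    - gProd (deriv (curve y z) x) (X x) • deriv (deriv (curve y z)) x
    + gProd (deriv (deriv (curve y z)) x) (X x) • deriv (curve y z) x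

/-- The tangent `T = α' = (1, y', z')`. -/
noncomputable def Tvec (y z : ℝ → ℝ) (x : ℝ) : Fin 3 → ℝ :=
  ![1, deriv y x, deriv z x]

/-- The curvature `κ = √(y''² + z''²)`. -/
noncomputable def kappa (y z : ℝ → ℝ) (x : ℝ) : ℝ :=
  Real.sqrt (deriv (deriv y) x ^ 2 + deriv (deriv z) x ^ 2)

/-- The principal normal `N = (1/κ)(0, y'', z'')`. -/
noncomputable def Nvec (y z : ℝ → ℝ) (x : ℝ) : Fin 3 → ℝ :=
  (kappa y z x)⁻¹ • ![0, deriv (deriv y) x, deriv (deriv z) x]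

/-- The binormal `B = (1/κ)(0, −z'', y'')`. -/
noncomputable def Bvec (y z : ℝ → ℝ) (x : ℝ) : Fin 3 → ℝ :=
  (kappa y z x)⁻¹ • ![0, -deriv (deriv z) x, deriv (deriv y) x]

/-- The torsion `τ = det(α', α'', α''') / κ²`. -/
noncomputable def tors (y z : ℝ → ℝ) (x : ℝ) : ℝ :=
  (Matrix.of ![![(1 : ℝ), deriv y x, deriv z x],
    ![0, deriv (deriv y) x, deriv (deriv z) x],
    ![0, deriv (deriv (deriv y)) x, deriv (deriv (deriv z)) x]]).det / kappa y z x ^ 2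

theorem hasDerivAt_vec3 {f g h : ℝ → ℝ} {f' g' h' x : ℝ} (hf : HasDerivAt f f' x)
    (hg : HasDerivAt g g' x) (hh : HasDerivAt h h' x) :
    HasDerivAt (fun t => ![f t, g t, h t]) ![f', g', h'] x := by
  rw [hasDerivAt_pi]
  intro i
  fin_cases i <;> simpa

theorem deriv_curve {y z : ℝ → ℝ} (hy : Differentiable ℝ y) (hz : Differentiable ℝ z) :
    deriv (curve y z) = Tvec y z :=
  funext fun x =>
    (hasDerivAt_vec3 (hasDerivAt_id' x) (hy x).hasDerivAt (hz x).hasDerivAt).deriv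

theorem hasDerivAt_Tvec {y z : ℝ → ℝ} {x : ℝ} (hy : DifferentiableAt ℝ (deriv y) x)
    (hz : DifferentiableAt ℝ (deriv z) x) :
    HasDerivAt (Tvec y z) ![0, deriv (deriv y) x, deriv (deriv z) x] x :=
  hasDerivAt_vec3 (hasDerivAt_const x 1) hy.hasDerivAt hz.hasDerivAt

theorem gProd_of_isotropic {v w : Fin 3 → ℝ} (hv : v 0 = 0) (hw : w 0 = 0) :
    gProd v w = v 1 * w 1 + v 2 * w 2 := by
  simp [gProd, hv, hw]

theorem gProd_of_right_ne_zero {v w : Fin 3 → ℝ} (hw : w 0 ≠ 0) :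
    gProd v w = v 0 * w 0 := by
  simp [gProd, hw]

/-- The dual relations of an orthonormal pair in the plane. -/
theorem orthonormal_columns {a b c d : ℝ} (hab : a ^ 2 + b ^ 2 = 1) (hcd : c ^ 2 + d ^ 2 = 1)
    (h : a * c + b * d = 0) :
    a ^ 2 + c ^ 2 = 1 ∧ b ^ 2 + d ^ 2 = 1 ∧ a * b + c * d = 0 := by
  have hM : !![a, b; c, d] * !![a, c; b, d] = (1 : Matrix (Fin 2) (Fin 2) ℝ) := by
    rw [Matrix.mul_fin_two, Matrix.one_fin_two]
    congr! 3 <;> grind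
  have hN := mul_eq_one_comm.mp hM
  rw [Matrix.mul_fin_two] at hN
  have h00 := congrFun₂ hN 0 0
  have h11 := congrFun₂ hN 1 1
  have h01 := congrFun₂ hN 0 1
  simp at h00 h11 h01
  exact ⟨by linarith, by linarith, h01⟩

/-- The derivative equations of an orthonormal isotropic frame: `Q' = τ n` and `n' = -τ Q`
with `τ = ⟨Q', n⟩`. -/
theorem deriv_isotropic_frame {Q n : ℝ → Fin 3 → ℝ} (hQ : Differentiable ℝ Q)
    (hn : Differentiable ℝ n) (hQiso : ∀ x, Q x 0 = 0) (hniso : ∀ x, n x 0 = 0)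
    (hQQ : ∀ x, Q x 1 ^ 2 + Q x 2 ^ 2 = 1) (hnn : ∀ x, n x 1 ^ 2 + n x 2 ^ 2 = 1)
    (hQn : ∀ x, Q x 1 * n x 1 + Q x 2 * n x 2 = 0) (x : ℝ) :
    deriv Q x = gProd (deriv Q x) (n x) • n x ∧
      deriv n x = -gProd (deriv Q x) (n x) • Q x := by
  have dQ := hasDerivAt_pi.mp (hQ x).hasDerivAt
  have dn := hasDerivAt_pi.mp (hn x).hasDerivAt
  have hQ0 : deriv Q x 0 = 0 :=
    (dQ 0).unique ((hasDerivAt_const x (0 : ℝ)).congr_of_eventuallyEq (.of_forall hQiso))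
  have hn0 : deriv n x 0 = 0 :=
    (dn 0).unique ((hasDerivAt_const x (0 : ℝ)).congr_of_eventuallyEq (.of_forall hniso))
  have eQQ := (((dQ 1).pow 2).add ((dQ 2).pow 2)).unique
    ((hasDerivAt_const x (1 : ℝ)).congr_of_eventuallyEq (.of_forall hQQ))
  have enn := (((dn 1).pow 2).add ((dn 2).pow 2)).unique
    ((hasDerivAt_const x (1 : ℝ)).congr_of_eventuallyEq (.of_forall hnn))
  have eQn := (((dQ 1).mul (dn 1)).add ((dQ 2).mul (dn 2))).unique
    ((hasDerivAt_const x (0 : ℝ)).congr_of_eventuallyEq (.of_forall hQn))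
  obtain ⟨h1, h2, h3⟩ := orthonormal_columns (hQQ x) (hnn x) (hQn x)
  rw [gProd_of_isotropic hQ0 (hniso x)]
  norm_num at eQQ enn
  constructor <;> ext i <;> fin_cases i <;>
    simp only [Fin.zero_eta, Fin.mk_one, Fin.reduceFinMk, Pi.smul_apply, smul_eq_mul]
  · rw [hQ0, hniso, mul_zero]
  · linear_combination (-deriv Q x 1) * h1 - deriv Q x 2 * h3 + Q x 1 / 2 * eQQ
  · linear_combination (-deriv Q x 1) * h3 - deriv Q x 2 * h2 + Q x 2 / 2 * eQQ
  · rw [hn0, hQiso, mul_zero]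
  · linear_combination (-deriv n x 1) * h1 - deriv n x 2 * h3 + n x 1 / 2 * enn + Q x 1 * eQn
  · linear_combination (-deriv n x 1) * h3 - deriv n x 2 * h2 + n x 2 / 2 * enn + Q x 2 * eQn

/-- a field `X = λ₁T + λ₂Q + λ₃n` with constant coefficients and
`λ₁ ≠ 0` is Fermi–Walker transported iff the geodesic torsion `τ_g` vanishes
identically (line of curvature) or `λ₂ = λ₃ = 0`. -/
theorem fermiWalker_transported_const_coeffs_darboux_iff
(y z : ℝ → ℝ) (hy : ContDiff ℝ (⊤ : ℕ∞) y) (hz : ContDiff ℝ (⊤ : ℕ∞) z)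
    (Q n : ℝ → Fin 3 → ℝ) (hQ : ContDiff ℝ (⊤ : ℕ∞) Q) (hn : ContDiff ℝ (⊤ : ℕ∞) n)
    (hQiso : ∀ x, Q x 0 = 0) (hniso : ∀ x, n x 0 = 0)
    (hQQ : ∀ x, Q x 1 ^ 2 + Q x 2 ^ 2 = 1)
    (hnn : ∀ x, n x 1 ^ 2 + n x 2 ^ 2 = 1)
    (hQn : ∀ x, Q x 1 * n x 1 + Q x 2 * n x 2 = 0)
(kg kn : ℝ → ℝ)
    (hkg : ∀ x, kg x = gProd (deriv (deriv (curve y z)) x) (Q x))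
    (hkn : ∀ x, kn x = gProd (deriv (deriv (curve y z)) x) (n x))
(tg : ℝ → ℝ) (htg : ∀ x, tg x = gProd (deriv Q x) (n x))
    (lam₁ lam₂ lam₃ : ℝ) (hlam₁ : lam₁ ≠ 0)
    (X : ℝ → Fin 3 → ℝ)
    (hX : ∀ x, X x = lam₁ • Tvec y z x + lam₂ • Q x + lam₃ • n x) :
    (∀ x : ℝ, FW y z X x = 0) ↔ ((∀ x : ℝ, tg x = 0) ∨ (lam₂ = 0 ∧ lam₃ = 0)) := by
  have hy1 : Differentiable ℝ y := hy.differentiable (by simp)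
  have hz1 : Differentiable ℝ z := hz.differentiable (by simp)
  have hy2 : Differentiable ℝ (deriv y) :=
    (contDiff_infty_iff_deriv.mp hy).2.differentiable (by simp)
  have hz2 : Differentiable ℝ (deriv z) :=
    (contDiff_infty_iff_deriv.mp hz).2.differentiable (by simp)
  have hQ1 : Differentiable ℝ Q := hQ.differentiable (by simp)
  have hn1 : Differentiable ℝ n := hn.differentiable (by simp)
  have hFW : ∀ x, FW y z X x = tg x • (lam₂ • n x - lam₃ • Q x) := by
    intro x
    obtain ⟨eQ, en⟩ := deriv_isotropic_frame hQ1 hn1 hQiso hniso hQQ hnn hQn x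
    rw [← htg] at eQ en
    have hT := hasDerivAt_Tvec (hy2 x) (hz2 x)
    have hT0 : Tvec y z x 0 = 1 := rfl
    have hX0 : X x 0 = lam₁ := by
      rw [hX, Pi.add_apply, Pi.add_apply]
      simp only [Pi.smul_apply, smul_eq_mul, hT0, hQiso, hniso, mul_one, mul_zero, add_zero]
    have hX' : deriv X x = lam₁ • deriv (Tvec y z) x + lam₂ • deriv Q x + lam₃ • deriv n x := by
      rw [funext hX]
      exact (((hT.differentiableAt.hasDerivAt.const_smul lam₁).add
        ((hQ1 x).hasDerivAt.const_smul lam₂)).add ((hn1 x).hasDerivAt.const_smul lam₃)).deriv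
    have hne : X x 0 ≠ 0 := hX0 ▸ hlam₁
    have hA0 : deriv (Tvec y z) x 0 = 0 := by rw [hT.deriv]; rfl
    rw [FW, deriv_curve hy1 hz1, gProd_of_right_ne_zero hne, gProd_of_right_ne_zero hne,
      hA0, hT0, hX0, hX', eQ, en]
    module
  have hnorm : ∀ x, lam₂ • n x - lam₃ • Q x = 0 → lam₂ = 0 ∧ lam₃ = 0 := by
    intro x h
    have h1 := congrFun h 1
    have h2 := congrFun h 2
    simp only [Pi.sub_apply, Pi.smul_apply, smul_eq_mul, Pi.zero_apply] at h1 h2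
    constructor
    · linear_combination n x 1 * h1 + n x 2 * h2 - lam₂ * hnn x + lam₃ * hQn x
    · linear_combination (-Q x 1) * h1 - Q x 2 * h2 - lam₃ * hQQ x + lam₂ * hQn x
  simp only [hFW, smul_eq_zero]
  constructor
  · intro h
    by_cases hl : lam₂ = 0 ∧ lam₃ = 0
    · exact Or.inr hl
    · exact Or.inl fun x => (h x).resolve_right fun hx => hl (hnorm x hx)
  · rintro (h | ⟨rfl, rfl⟩) x
    · exact Or.inl (h x)
    · right; simp
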